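/- Let 1 ≤ p₁ < 2 < p₂ < ∞. Then there is a constant C > 0, independent of N and k, such that for all N, k ∈ ℕ: d_k(id : ℓ_{p₁}^N → ℓ_{p₂}^N) ≤ C if k ≤ N^{2/p₂}; d_k(id : ℓ_{p₁}^N → ℓ_{p₂}^N) ≤ C · N^{1/p₂} k^{−1/2} if N^{2/p₂} < k ≤ N; and d_k(id : ℓ_{p₁}^N → ℓ_{p₂}^N) = 0 if k > N. -/

import Mathlib

open scoped ENNReal

/-- The `k`-th Kolmogorov number of a continuous linear operator `T : X → Y`. -/
noncomputable def kolmogorovNumber {X Y : Type*} [NormedAddCommGroup X] [NormedSpace ℂ X]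
    [NormedAddCommGroup Y] [NormedSpace ℂ Y] (T : X →L[ℂ] Y) (k : ℕ) : ℝ :=
  sInf { r | ∃ L : Submodule ℂ Y, Module.rank ℂ L < (k : Cardinal) ∧
    r = ⨆ x : {x : X // ‖x‖ ≤ 1}, ⨅ z : L, ‖T x.1 - (z : Y)‖ }

/-- The identity operator `id : ℓ_{p₁}^N → ℓ_{p₂}^N` on `ℂ^N`. -/
noncomputable def lpId (p₁ p₂ : ℝ≥0∞) [Fact (1 ≤ p₁)] [Fact (1 ≤ p₂)] (N : ℕ) :
    PiLp p₁ (fun _ : Fin N => ℂ) →L[ℂ] PiLp p₂ (fun _ : Fin N => ℂ) :=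
  LinearMap.toContinuousLinearMap
    (((WithLp.linearEquiv p₂ ℂ (Fin N → ℂ)).symm.toLinearMap).comp
      (WithLp.linearEquiv p₁ ℂ (Fin N → ℂ)).toLinearMap)

/-- The sign attached to a Boolean. -/
noncomputable def boolSign (b : Bool) : ℝ := if b then 1 else -1

/-- The Rademacher sum `∑ i, ±bᵢ` with signs `ε`. -/
noncomputable def signSum {ι : Type*} [Fintype ι] (ε : ι → Bool) (b : ι → ℝ) : ℝ :=
  ∑ i, boolSign (ε i) * b i

lemma sum_bool_fun_succ {m : ℕ} (f : (Fin (m + 1) → Bool) → ℝ) :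
    ∑ ε, f ε = ∑ ε : Fin m → Bool, (f (Fin.cons true ε) + f (Fin.cons false ε)) := by
  rw [← (Fin.consEquiv (fun _ : Fin (m + 1) => Bool)).sum_comp, Fintype.sum_prod_type_right]
  simp [Fin.consEquiv]

lemma signSum_cons {m : ℕ} (e : Bool) (ε : Fin m → Bool) (b : Fin (m + 1) → ℝ) :
    signSum (Fin.cons e ε : Fin (m + 1) → Bool) b
      = boolSign e * b 0 + signSum ε (fun i => b i.succ) := by
  simp [signSum, Fin.sum_univ_succ]

/-- Subgaussian estimate for Rademacher sums. -/
lemma sum_exp_sq_signSum_le {m : ℕ} (b : Fin m → ℝ) {μ : ℝ} (hμ : 0 ≤ μ)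
    (h : 4 * μ * ∑ i, b i ^ 2 ≤ 1) :
    ∑ ε : Fin m → Bool, Real.exp (μ * signSum ε b ^ 2)
      ≤ 2 ^ m * Real.exp (2 * μ * ∑ i, b i ^ 2) := by
  induction m generalizing μ with
  | zero => simp [signSum]
  | succ m ih =>
    rw [sum_bool_fun_succ]
    rw [Fin.sum_univ_succ] at h ⊢
    set c := b 0
    set T := ∑ i : Fin m, b i.succ ^ 2
    have hT : 0 ≤ T := Finset.sum_nonneg fun i _ => sq_nonneg _
    have hc : 0 ≤ c ^ 2 := sq_nonneg c
    have hμT : 0 ≤ μ * T := mul_nonneg hμ hT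
    have hμc : 0 ≤ μ * c ^ 2 := mul_nonneg hμ hc
    have key : ∀ X : ℝ, Real.exp (μ * (c + X) ^ 2) + Real.exp (μ * (-c + X) ^ 2)
        ≤ 2 * Real.exp (μ * c ^ 2) * Real.exp ((μ + 2 * μ ^ 2 * c ^ 2) * X ^ 2) := by
      intro X
      have h1 := Real.cosh_le_exp_half_sq (2 * μ * c * X)
      have h2 : Real.exp (μ * (c + X) ^ 2) + Real.exp (μ * (-c + X) ^ 2)
          = 2 * Real.exp (μ * (c ^ 2 + X ^ 2)) * Real.cosh (2 * μ * c * X) := by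
        rw [Real.cosh_eq, show μ * (c + X) ^ 2 = μ * (c ^ 2 + X ^ 2) + 2 * μ * c * X by ring,
          show μ * (-c + X) ^ 2 = μ * (c ^ 2 + X ^ 2) + -(2 * μ * c * X) by ring,
          Real.exp_add, Real.exp_add]
        ring
      rw [h2]
      refine (mul_le_mul_of_nonneg_left h1 (by positivity)).trans (le_of_eq ?_)
      rw [mul_assoc, mul_assoc 2 (Real.exp (μ * c ^ 2)), ← Real.exp_add, ← Real.exp_add]
      ring_nf
    have h' : 4 * (μ + 2 * μ ^ 2 * c ^ 2) * T ≤ 1 := by nlinarith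
    calc _ ≤ ∑ ε : Fin m → Bool, 2 * Real.exp (μ * c ^ 2) *
            Real.exp ((μ + 2 * μ ^ 2 * c ^ 2) * signSum ε (fun i => b i.succ) ^ 2) := by
          refine Finset.sum_le_sum fun ε _ => ?_
          simpa [signSum_cons, boolSign] using key (signSum ε (fun i => b i.succ))
      _ ≤ 2 * Real.exp (μ * c ^ 2) *
            (2 ^ m * Real.exp (2 * (μ + 2 * μ ^ 2 * c ^ 2) * T)) := by
          rw [← Finset.mul_sum]
          gcongr
          exact ih _ (by positivity) h'
      _ = 2 ^ (m + 1) * Real.exp (μ * c ^ 2 + 2 * (μ + 2 * μ ^ 2 * c ^ 2) * T) := by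
          rw [Real.exp_add]; ring
      _ ≤ _ := by
          gcongr
          nlinarith

lemma sum_signSum_mul_signSum {m : ℕ} (u y : Fin m → ℝ) :
    ∑ ε : Fin m → Bool, signSum ε u * signSum ε y = 2 ^ m * ∑ i, u i * y i := by
  induction m with
  | zero => simp [signSum]
  | succ m ih =>
    rw [sum_bool_fun_succ, Fin.sum_univ_succ, mul_add, pow_succ]
    have := ih (fun i => u i.succ) (fun i => y i.succ)
    rw [mul_assoc, mul_assoc, mul_left_comm _ 2 (∑ _, _), ← this]
    simp only [signSum_cons, boolSign, Finset.mul_sum]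
    have h2 : (2 : ℝ) ^ m * (2 * (u 0 * y 0)) = ∑ ε : Fin m → Bool, 2 * (u 0 * y 0) := by
      simp
    rw [h2, ← Finset.sum_add_distrib]
    refine Finset.sum_congr rfl fun ε _ => ?_
    simp
    ring

lemma exp_mul_le_of_abs_le {t V : ℝ} (ht : |t| ≤ 1 / 8) :
    Real.exp (t * V) ≤ 1 + t * V + 128 * t ^ 2 * Real.exp (|V| / 4) := by
  have h1 : Real.exp (t * V) ≤ 1 + t * V + (t * V) ^ 2 * Real.exp |t * V| := by
    have h := Complex.norm_exp_sub_sum_le_norm_mul_exp (t * V : ℝ) 2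
    have h' : Complex.exp (t * V : ℝ) - ∑ m ∈ Finset.range 2, ((t * V : ℝ) : ℂ) ^ m / m.factorial
        = ((Real.exp (t * V) - (1 + t * V) : ℝ) : ℂ) := by
      simp [Finset.sum_range_succ]
    rw [h', Complex.norm_real, Complex.norm_real] at h
    have := le_of_abs_le h
    rw [Real.norm_eq_abs, sq_abs] at this
    linarith
  have h2 : V ^ 2 ≤ 128 * Real.exp (|V| / 8) := by
    have := Real.quadratic_le_exp_of_nonneg (x := |V| / 8) (by positivity)
    nlinarith [abs_nonneg V, sq_abs V]
  have h3 : Real.exp |t * V| ≤ Real.exp (|V| / 8) := by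
    rw [Real.exp_le_exp, abs_mul]; nlinarith [abs_nonneg V]
  have h4 : (t * V) ^ 2 * Real.exp |t * V|
      ≤ t ^ 2 * (128 * Real.exp (|V| / 8)) * Real.exp (|V| / 8) := by
    rw [mul_pow]; gcongr
  have h5 : t ^ 2 * (128 * Real.exp (|V| / 8)) * Real.exp (|V| / 8)
      = 128 * t ^ 2 * Real.exp (|V| / 4) := by
    rw [show |V| / 4 = |V| / 8 + |V| / 8 by ring, Real.exp_add]; ring
  linarith

lemma sum_exp_signSum_mul_le {m : ℕ} (u y : Fin m → ℝ) (hu : ∑ i, u i ^ 2 ≤ 1)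
    (hy : ∑ i, y i ^ 2 ≤ 1) {t : ℝ} (ht : |t| ≤ 1 / 8) :
    ∑ ε : Fin m → Bool, Real.exp (t * (signSum ε u * signSum ε y - ∑ i, u i * y i))
      ≤ 2 ^ m * Real.exp (384 * t ^ 2) := by
  set c := ∑ i, u i * y i
  have hc : |c| ≤ 1 := by
    have := Finset.sum_mul_sq_le_sq_mul_sq Finset.univ u y
    have h0 : 0 ≤ ∑ i, y i ^ 2 := Finset.sum_nonneg fun i _ => sq_nonneg _
    rw [abs_le_one_iff_mul_self_le_one]
    nlinarith
  have hV : ∀ ε : Fin m → Bool, Real.exp (|signSum ε u * signSum ε y - c| / 4)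
      ≤ Real.exp (1 / 4) / 2 * (Real.exp (1 / 4 * signSum ε u ^ 2)
        + Real.exp (1 / 4 * signSum ε y ^ 2)) := by
    intro ε
    set X := signSum ε u
    set Y := signSum ε y
    have h1 : |X * Y - c| ≤ (X ^ 2 + Y ^ 2) / 2 + 1 := by
      refine (abs_sub _ _).trans (add_le_add ?_ hc)
      rw [abs_le]; constructor <;> nlinarith [sq_nonneg (X + Y), sq_nonneg (X - Y)]
    have h2 : Real.exp (|X * Y - c| / 4)
        ≤ Real.exp (1 / 4) * (Real.exp (X ^ 2 / 8) * Real.exp (Y ^ 2 / 8)) := by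
      rw [← Real.exp_add, ← Real.exp_add]; gcongr; linarith
    have h3 : Real.exp (1 / 4 * X ^ 2) = Real.exp (X ^ 2 / 8) ^ 2 := by
      rw [← Real.exp_nat_mul]; ring_nf
    have h4 : Real.exp (1 / 4 * Y ^ 2) = Real.exp (Y ^ 2 / 8) ^ 2 := by
      rw [← Real.exp_nat_mul]; ring_nf
    rw [h3, h4]
    nlinarith [sq_nonneg (Real.exp (X ^ 2 / 8) - Real.exp (Y ^ 2 / 8)), Real.exp_pos (1 / 4 : ℝ)]
  have hsq : ∀ v : Fin m → ℝ, ∑ i, v i ^ 2 ≤ 1 →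
      ∑ ε : Fin m → Bool, Real.exp (1 / 4 * signSum ε v ^ 2) ≤ 2 ^ m * Real.exp (1 / 2) := by
    intro v hv
    refine (sum_exp_sq_signSum_le v (by norm_num) (by linarith)).trans ?_
    gcongr; linarith
  have h3 : Real.exp (1 / 4) * Real.exp (1 / 2) ≤ 3 := by
    rw [← Real.exp_add]
    exact ((Real.exp_le_exp.2 (by norm_num)).trans Real.exp_one_lt_d9.le).trans (by norm_num)
  calc _ ≤ ∑ ε : Fin m → Bool, (1 + t * (signSum ε u * signSum ε y - c) + 128 * t ^ 2 *
          (Real.exp (1 / 4) / 2 * (Real.exp (1 / 4 * signSum ε u ^ 2)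
        + Real.exp (1 / 4 * signSum ε y ^ 2)))) := by
        refine Finset.sum_le_sum fun ε _ => (exp_mul_le_of_abs_le ht).trans ?_
        gcongr
        exact hV ε
    _ = 2 ^ m + 128 * t ^ 2 * (Real.exp (1 / 4) / 2 *
          (∑ ε : Fin m → Bool, Real.exp (1 / 4 * signSum ε u ^ 2)
            + ∑ ε : Fin m → Bool, Real.exp (1 / 4 * signSum ε y ^ 2))) := by
        have := sum_signSum_mul_signSum u y
        rw [Finset.sum_add_distrib, Finset.sum_add_distrib, ← Finset.mul_sum, ← Finset.mul_sum,
          ← Finset.mul_sum, Finset.sum_sub_distrib, this, Finset.sum_add_distrib]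
        simp [c]
    _ ≤ 2 ^ m + 128 * t ^ 2 * (Real.exp (1 / 4) / 2 *
          (2 ^ m * Real.exp (1 / 2) + 2 ^ m * Real.exp (1 / 2))) := by
        gcongr
        exacts [hsq u hu, hsq y hy]
    _ = 2 ^ m + 2 ^ m * (128 * t ^ 2) * (Real.exp (1 / 4) * Real.exp (1 / 2)) := by ring
    _ ≤ 2 ^ m + 2 ^ m * (128 * t ^ 2) * 3 := by gcongr
    _ = 2 ^ m * (384 * t ^ 2 + 1) := by ring
    _ ≤ _ := by gcongr; exact Real.add_one_le_exp _

/-- Exponential Markov inequality for the uniform measure on a finite type. -/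
lemma card_filter_le_of_sum_exp_le {α : Type*} [Fintype α] (p : α → Prop) [DecidablePred p]
    (F : α → ℝ) {a M : ℝ} (hp : ∀ x, p x → a ≤ F x) (hM : ∑ x, Real.exp (F x) ≤ M) :
    ((Finset.univ.filter p).card : ℝ) ≤ M * Real.exp (-a) := by
  have h : ((Finset.univ.filter p).card : ℝ) * Real.exp a ≤ M := by
    refine le_trans ?_ hM
    rw [← nsmul_eq_mul]
    refine (Finset.card_nsmul_le_sum _ (fun x => Real.exp (F x)) _ fun x hx => ?_).trans
      (Finset.sum_le_sum_of_subset_of_nonneg (Finset.subset_univ _) fun _ _ _ => by positivity)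
    exact Real.exp_le_exp.2 (hp x (Finset.mem_filter.1 hx).2)
  rw [Real.exp_neg]
  exact (le_div_iff₀ (Real.exp_pos a)).2 h

/-- One-sided deviation of the bilinear form of a random sign matrix. -/
lemma card_bilinear_deviation_le {n N : ℕ} (u y : Fin N → ℝ) (hu : ∑ i, u i ^ 2 ≤ 1)
    (hy : ∑ i, y i ^ 2 ≤ 1) :
    ((Finset.univ.filter fun σ : Fin n → Fin N → Bool =>
      (n : ℝ) / 8 ≤ ∑ l, signSum (σ l) u * signSum (σ l) y - n * ∑ i, u i * y i).card : ℝ)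
      ≤ (2 ^ N) ^ n * Real.exp (-(n / 98304)) := by
  set c := ∑ i, u i * y i
  have hM : ∑ σ : Fin n → Fin N → Bool,
      Real.exp (∑ l, 1 / 6144 * (signSum (σ l) u * signSum (σ l) y - c))
      ≤ (2 ^ N * Real.exp (384 * (1 / 6144) ^ 2)) ^ n := by
    simp_rw [Real.exp_sum]
    rw [← Fintype.sum_pow
      (fun ε : Fin N → Bool => Real.exp (1 / 6144 * (signSum ε u * signSum ε y - c)))]
    gcongr
    exact sum_exp_signSum_mul_le u y hu hy (by norm_num [abs_of_pos])
  refine (card_filter_le_of_sum_exp_le _ _ (a := n / 49152) ?_ hM).trans (le_of_eq ?_)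
  · intro σ hσ
    rw [← Finset.mul_sum, Finset.sum_sub_distrib]
    simp
    linarith
  · rw [mul_pow, ← Real.exp_nat_mul, mul_assoc, ← Real.exp_add]
    ring_nf

lemma sum_prod_compl_le {ι α : Type*} [Fintype ι] [DecidableEq ι] [Fintype α]
    (S : Finset ι) (w : ({i // i ∈ S} → α) → α → ℝ) (hw : ∀ f a, 0 ≤ w f a) {B : ℝ} (hB : 1 ≤ B)
    (h : ∀ f, ∑ a, w f a ≤ Fintype.card α * B) :
    ∑ τ : ι → α, ∏ i ∈ Sᶜ, w (fun j => τ j) (τ i)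
      ≤ (Fintype.card α : ℝ) ^ Fintype.card ι * B ^ Fintype.card ι := by
  classical
  rw [← (Equiv.piEquivPiSubtypeProd (fun i => i ∈ S) (fun _ => α)).symm.sum_comp,
    Fintype.sum_prod_type]
  have h1 : ∀ (f : {i // i ∈ S} → α) (g : {i // i ∉ S} → α),
      ∏ i ∈ Sᶜ, w (fun j : {i // i ∈ S} =>
        (Equiv.piEquivPiSubtypeProd (fun i => i ∈ S) (fun _ => α)).symm (f, g) j)
        ((Equiv.piEquivPiSubtypeProd (fun i => i ∈ S) (fun _ => α)).symm (f, g) i)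
      = ∏ i : {i // i ∉ S}, w f (g i) := by
    intro f g
    rw [Finset.prod_subtype (p := fun i => i ∉ S) Sᶜ (by simp)]
    refine Finset.prod_congr rfl fun i _ => ?_
    simp [Equiv.piEquivPiSubtypeProd, i.2]
  simp_rw [h1]
  have h2 : ∀ f : {i // i ∈ S} → α, ∑ g : {i // i ∉ S} → α, ∏ i, w f (g i)
      ≤ (Fintype.card α * B) ^ Fintype.card {i // i ∉ S} := by
    intro f
    rw [← Fintype.prod_sum (fun (_ : {i // i ∉ S}) a => w f a), Finset.prod_const]
    exact pow_le_pow_left₀ (Finset.sum_nonneg fun a _ => hw f a) (h f) _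
  refine (Finset.sum_le_sum fun f _ => h2 f).trans ?_
  have hcard : Fintype.card ι = Fintype.card {i // i ∈ S} + Fintype.card {i // i ∉ S} := by
    rw [Fintype.card_subtype_compl]
    have := Fintype.card_subtype_le (fun i => i ∈ S)
    omega
  rw [Finset.sum_const, nsmul_eq_mul, Finset.card_univ, Fintype.card_fun, mul_pow, hcard]
  push_cast
  rw [← mul_assoc, ← pow_add]
  gcongr
  omega

lemma abs_rpow_le_exp_sq {q : ℝ} (hq : 0 < q) (g : ℝ) :
    |g| ^ q ≤ (8 * q) ^ (q / 2) * Real.exp (g ^ 2 / 16) := by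
  have h0 : (0 : ℝ) ≤ g ^ 2 / (8 * q) := by positivity
  have h1 : |g| ^ q = (8 * q) ^ (q / 2) * (g ^ 2 / (8 * q)) ^ (q / 2) := by
    rw [← Real.mul_rpow (by positivity) h0, mul_div_cancel₀ _ (by positivity), ← sq_abs,
      ← Real.rpow_natCast, ← Real.rpow_mul (abs_nonneg g)]
    congr 1
    push_cast; ring
  have h2 : (g ^ 2 / (8 * q)) ^ (q / 2) ≤ Real.exp (g ^ 2 / (8 * q)) ^ (q / 2) := by
    gcongr
    linarith [Real.add_one_le_exp (g ^ 2 / (8 * q))]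
  rw [← Real.exp_mul] at h2
  rw [h1]
  gcongr
  refine h2.trans (le_of_eq ?_)
  congr 1
  field_simp
  ring

/-- The `i`-th coordinate of `n ^ (-1/2) • σᵀ σ y`. -/
noncomputable def gramSum {n N : ℕ} (σ : Fin n → Fin N → Bool) (y : Fin N → ℝ) (i : Fin N) : ℝ :=
  signSum (fun l => σ l i) (fun l => signSum (σ l) y / √n)

/-- The weight comparing the `q`-th power of a coordinate with its square. -/
noncomputable def mixedWeight (q κ g : ℝ) : ℝ := min (κ * |g| ^ q) (g ^ 2)

lemma sum_exp_mixedWeight_le {n : ℕ} {q κ : ℝ} (hq : 0 < q) (hκ : 0 ≤ κ) (b : Fin n → ℝ)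
    (hb : ∑ l, b l ^ 2 ≤ 2) :
    ∑ ε : Fin n → Bool, Real.exp (1 / 16 * mixedWeight q κ (signSum ε b))
      ≤ 2 ^ n * Real.exp (κ * (8 * q) ^ (q / 2)) := by
  set D := (8 * q) ^ (q / 2)
  have hD : 0 ≤ D := by positivity
  have hpt : ∀ g : ℝ, Real.exp (1 / 16 * mixedWeight q κ g)
      ≤ 1 + κ * D / 16 * Real.exp (1 / 8 * g ^ 2) := by
    intro g
    set ψ := mixedWeight q κ g
    have h0 : 0 ≤ ψ := le_min (by positivity) (by positivity)
    have h1 : ψ ≤ κ * (D * Real.exp (g ^ 2 / 16)) :=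
      (min_le_left _ _).trans (by gcongr; exact abs_rpow_le_exp_sq hq g)
    have h2 : ψ ≤ g ^ 2 := min_le_right _ _
    have h3 : Real.exp (1 / 16 * ψ) ≤ 1 + 1 / 16 * ψ * Real.exp (1 / 16 * ψ) := by
      have := Real.add_one_le_exp (-(1 / 16 * ψ))
      rw [Real.exp_neg] at this
      have hp := Real.exp_pos (1 / 16 * ψ)
      have := mul_le_mul_of_nonneg_right this hp.le
      rw [inv_mul_cancel₀ hp.ne'] at this
      linarith
    have h4 : Real.exp (1 / 16 * ψ) ≤ Real.exp (g ^ 2 / 16) := by gcongr; linarith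
    have h5 : 1 / 16 * ψ * Real.exp (1 / 16 * ψ)
        ≤ 1 / 16 * (κ * (D * Real.exp (g ^ 2 / 16))) * Real.exp (g ^ 2 / 16) := by gcongr
    have h6 : Real.exp (1 / 8 * g ^ 2) = Real.exp (g ^ 2 / 16) * Real.exp (g ^ 2 / 16) := by
      rw [← Real.exp_add]; ring_nf
    rw [h6]
    linarith
  have he : Real.exp (1 / 2) ≤ 16 :=
    ((Real.exp_le_exp.2 (by norm_num)).trans Real.exp_one_lt_d9.le).trans (by norm_num)
  have hsum : ∑ ε : Fin n → Bool, Real.exp (1 / 8 * signSum ε b ^ 2) ≤ 2 ^ n * 16 := by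
    refine (sum_exp_sq_signSum_le b (by norm_num) (by linarith)).trans ?_
    gcongr
    refine le_trans ?_ he
    gcongr; linarith
  calc _ ≤ ∑ ε : Fin n → Bool, (1 + κ * D / 16 * Real.exp (1 / 8 * signSum ε b ^ 2)) :=
        Finset.sum_le_sum fun ε _ => hpt _
    _ = 2 ^ n + κ * D / 16 * ∑ ε : Fin n → Bool, Real.exp (1 / 8 * signSum ε b ^ 2) := by
        rw [Finset.sum_add_distrib, ← Finset.mul_sum]; simp
    _ ≤ 2 ^ n + κ * D / 16 * (2 ^ n * 16) := by gcongr
    _ = 2 ^ n * (κ * D + 1) := by ring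
    _ ≤ _ := by gcongr; exact Real.add_one_le_exp _

open Classical in
/-- Outside the support of `y`, the coordinates of `σᵀ σ y` are rarely large. -/
lemma card_mixedWeight_deviation_le {n N : ℕ} (hn : 0 < n) (hN : 0 < N) {q : ℝ} (hq : 0 < q)
    (y : Fin N → ℝ) {κ : ℝ} (hκ : κ = n / N / (512 * (8 * q) ^ (q / 2))) :
    ((Finset.univ.filter fun σ : Fin n → Fin N → Bool =>
      ∑ l, signSum (σ l) y ^ 2 ≤ 2 * n ∧
        (n : ℝ) / 16 ≤ ∑ i with y i = 0, mixedWeight q κ (gramSum σ y i)).card : ℝ)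
      ≤ (2 ^ N) ^ n * Real.exp (-(n / 512)) := by
  have hD : 0 < (8 * q) ^ (q / 2) := by positivity
  have hn' : (0 : ℝ) < n := by exact_mod_cast hn
  have hN' : (0 : ℝ) < N := by exact_mod_cast hN
  have hκ0 : 0 ≤ κ := by rw [hκ]; positivity
  set S : Finset (Fin N) := Finset.univ.filter fun i => y i ≠ 0
  have hS : Sᶜ = Finset.univ.filter fun i => y i = 0 := by ext; simp [S]
  let H : ({i // i ∈ S} → Fin n → Bool) → Fin n → ℝ :=
    fun f l => signSum (fun j => f j l) (fun j => y j)
  let w : ({i // i ∈ S} → Fin n → Bool) → (Fin n → Bool) → ℝ := fun f a =>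
    if ∑ l, H f l ^ 2 ≤ 2 * n then
      Real.exp (1 / 16 * mixedWeight q κ (signSum a fun l => H f l / √n)) else 1
  have hH : ∀ σ : Fin n → Fin N → Bool, ∀ l, H (fun j l => σ l j) l = signSum (σ l) y := by
    intro σ l
    simp only [H, signSum]
    rw [← Finset.sum_subtype S (by simp) (fun i => boolSign (σ l i) * y i)]
    refine Finset.sum_subset (Finset.subset_univ _) fun i _ hi => ?_
    have : y i = 0 := by simpa [S] using hi
    simp [this]
  have hw0 : ∀ f a, 0 ≤ w f a := by
    intro f a; simp only [w]; split_ifs <;> positivity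
  have hB : 1 ≤ Real.exp (κ * (8 * q) ^ (q / 2)) := Real.one_le_exp (by positivity)
  have hw : ∀ f, ∑ a, w f a
      ≤ Fintype.card (Fin n → Bool) * Real.exp (κ * (8 * q) ^ (q / 2)) := by
    intro f
    simp only [w, Fintype.card_fun, Fintype.card_bool, Fintype.card_fin]
    push_cast
    split_ifs with h
    · refine sum_exp_mixedWeight_le hq hκ0 _ ?_
      simp_rw [div_pow, Real.sq_sqrt hn'.le]
      rw [← Finset.sum_div, div_le_iff₀ hn']
      exact h
    · simp only [Finset.sum_const, Finset.card_univ, Fintype.card_fun, Fintype.card_bool,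
        Fintype.card_fin, nsmul_eq_mul, mul_one]
      push_cast
      exact le_mul_of_one_le_right (by positivity) hB
  have hprod := sum_prod_compl_le S w hw0 hB hw
  rw [← (Equiv.piComm (fun (_ : Fin n) (_ : Fin N) => Bool)).sum_comp] at hprod
  let F : (Fin n → Fin N → Bool) → ℝ := fun σ =>
    ∑ i ∈ Sᶜ, Real.log (w (fun j l => σ l j) (fun l => σ l i))
  have hwpos : ∀ f a, 0 < w f a := by
    intro f a; simp only [w]; split_ifs <;> positivity
  have hM : ∑ σ, Real.exp (F σ) ≤ (Fintype.card (Fin n → Bool) : ℝ) ^ Fintype.card (Fin N)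
      * Real.exp (κ * (8 * q) ^ (q / 2)) ^ Fintype.card (Fin N) := by
    refine le_trans (le_of_eq ?_) hprod
    refine Finset.sum_congr rfl fun σ _ => ?_
    simp only [F]
    rw [Real.exp_sum]
    refine Finset.prod_congr rfl fun i _ => ?_
    rw [Real.exp_log (hwpos _ _)]
    rfl
  refine (card_filter_le_of_sum_exp_le _ F (a := n / 256) ?_ hM).trans (le_of_eq ?_)
  · rintro σ ⟨h1, h2⟩
    simp only [F, w, hH, if_pos h1, Real.log_exp]
    rw [← Finset.mul_sum, hS]
    simp only [gramSum] at h2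
    linarith
  · have : (N : ℝ) * (κ * (8 * q) ^ (q / 2)) = n / 512 := by rw [hκ]; field_simp
    rw [← Real.exp_nat_mul]
    simp only [Fintype.card_fun, Fintype.card_bool, Fintype.card_fin]
    rw [this, mul_assoc, ← Real.exp_add]
    push_cast
    rw [← pow_mul, ← pow_mul, mul_comm n N]
    congr 2
    ring

lemma card_biUnion_le_mul {α β : Type*} [DecidableEq β] (s : Finset α) (f : α → Finset β) {A : ℝ}
    (h : ∀ a ∈ s, ((f a).card : ℝ) ≤ A) : ((s.biUnion f).card : ℝ) ≤ s.card * A := by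
  have h1 : ((s.biUnion f).card : ℝ) ≤ ∑ a ∈ s, ((f a).card : ℝ) := by
    exact_mod_cast Finset.card_biUnion_le
  rw [← nsmul_eq_mul]
  exact h1.trans (Finset.sum_le_card_nsmul _ _ A h)

/-- A sign matrix acting almost isometrically on a finite set `Y` and with small coordinates of
`σᵀ σ y` off the support of each `y ∈ Y`. -/
lemma exists_good_signs {n N : ℕ} (hn : 0 < n) (hN : 0 < N) {q : ℝ} (hq : 0 < q)
    {κ : ℝ} (hκ : κ = n / N / (512 * (8 * q) ^ (q / 2))) (Y : Finset (Fin N → ℝ))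
    (hY : ∀ y ∈ Y, ∑ i, y i ^ 2 ≤ 1)
    (hcard : 3 * (Y.card : ℝ) ^ 2 * Real.exp (-(n / 98304)) < 1) :
    ∃ σ : Fin n → Fin N → Bool,
      (∀ u ∈ Y, ∀ y ∈ Y,
        |∑ l, signSum (σ l) u * signSum (σ l) y - n * ∑ i, u i * y i| ≤ n / 8) ∧
      ∀ y ∈ Y, ∑ i with y i = 0, mixedWeight q κ (gramSum σ y i) ≤ n / 16 := by
  classical
  let E1 : (Fin N → ℝ) × (Fin N → ℝ) → Finset (Fin n → Fin N → Bool) := fun p =>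
    Finset.univ.filter fun σ => (n : ℝ) / 8 ≤
      ∑ l, signSum (σ l) p.1 * signSum (σ l) p.2 - n * ∑ i, p.1 i * p.2 i
  let E2 : (Fin N → ℝ) → Finset (Fin n → Fin N → Bool) := fun y =>
    Finset.univ.filter fun σ => ∑ l, signSum (σ l) y ^ 2 ≤ 2 * n ∧
        (n : ℝ) / 16 ≤ ∑ i with y i = 0, mixedWeight q κ (gramSum σ y i)
  set A : ℝ := (2 ^ N) ^ n * Real.exp (-(n / 98304))
  have hA1 : ∀ p ∈ Y ×ˢ Y, ((E1 p).card : ℝ) ≤ A := by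
    intro p hp
    rw [Finset.mem_product] at hp
    exact card_bilinear_deviation_le _ _ (hY _ hp.1) (hY _ hp.2)
  have hA1' : ∀ p ∈ Y ×ˢ Y, ((E1 (-p.1, p.2)).card : ℝ) ≤ A := by
    intro p hp
    rw [Finset.mem_product] at hp
    exact card_bilinear_deviation_le _ _ (by simpa using hY _ hp.1) (hY _ hp.2)
  have hA2 : ∀ y ∈ Y, ((E2 y).card : ℝ) ≤ A := by
    intro y _
    refine (card_mixedWeight_deviation_le hn hN hq y hκ).trans ?_
    simp only [A]
    gcongr
    linarith [show (n : ℝ) / 98304 ≤ n / 512 by gcongr; norm_num]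
  let bad := ((Y ×ˢ Y).biUnion E1 ∪ (Y ×ˢ Y).biUnion fun p => E1 (-p.1, p.2)) ∪ Y.biUnion E2
  have hbad : (bad.card : ℝ) ≤ 3 * (Y.card : ℝ) ^ 2 * A := by
    have h1 : (((Y ×ˢ Y).biUnion E1).card : ℝ) ≤ (Y.card : ℝ) ^ 2 * A := by
      refine (card_biUnion_le_mul _ _ hA1).trans (le_of_eq ?_)
      rw [Finset.card_product]; push_cast; ring
    have h2 : (((Y ×ˢ Y).biUnion fun p => E1 (-p.1, p.2)).card : ℝ) ≤ (Y.card : ℝ) ^ 2 * A := by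
      refine (card_biUnion_le_mul _ _ hA1').trans (le_of_eq ?_)
      rw [Finset.card_product]; push_cast; ring
    have h3 : ((Y.biUnion E2).card : ℝ) ≤ (Y.card : ℝ) ^ 2 * A := by
      refine (card_biUnion_le_mul _ _ hA2).trans ?_
      gcongr
      exact_mod_cast Nat.le_self_pow two_ne_zero _
    have h4 : (bad.card : ℝ) ≤ ((Y ×ˢ Y).biUnion E1).card
        + ((Y ×ˢ Y).biUnion fun p => E1 (-p.1, p.2)).card + (Y.biUnion E2).card := by
      have := Finset.card_union_le ((Y ×ˢ Y).biUnion E1) ((Y ×ˢ Y).biUnion fun p => E1 (-p.1, p.2))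
      exact_mod_cast (Finset.card_union_le _ _).trans (by gcongr)
    linarith
  have hlt : bad.card < Fintype.card (Fin n → Fin N → Bool) := by
    have : (bad.card : ℝ) < (2 ^ N) ^ n := by
      refine hbad.trans_lt ?_
      have h0 : (0 : ℝ) < (2 ^ N) ^ n := by positivity
      calc _ = (2 ^ N) ^ n * (3 * (Y.card : ℝ) ^ 2 * Real.exp (-(n / 98304))) := by
            simp only [A]; ring
        _ < (2 ^ N) ^ n * 1 := by gcongr
        _ = _ := mul_one _
    simp only [Fintype.card_fun, Fintype.card_bool, Fintype.card_fin]
    exact_mod_cast this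
  obtain ⟨σ, hσ⟩ : ∃ σ, σ ∉ bad := by
    by_contra! h
    exact hlt.ne (by rw [Finset.eq_univ_of_forall h, Finset.card_univ])
  simp only [bad, Finset.mem_union, not_or, Finset.mem_biUnion, not_exists, not_and, E1, E2,
    Finset.mem_filter, Finset.mem_univ, true_and, Finset.mem_product, Prod.forall, not_le] at hσ
  obtain ⟨⟨h1, h2⟩, h3⟩ := hσ
  have habs : ∀ u ∈ Y, ∀ y ∈ Y,
      |∑ l, signSum (σ l) u * signSum (σ l) y - n * ∑ i, u i * y i| ≤ n / 8 := by
    intro u hu y hy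
    have e1 := h1 u y ⟨hu, hy⟩
    have e2 := h2 u y ⟨hu, hy⟩
    have e3 : ∀ l, signSum (σ l) (-u) = -signSum (σ l) u := by simp [signSum]
    simp only [e3, neg_mul, Finset.sum_neg_distrib, Pi.neg_apply] at e2
    rw [abs_le]
    constructor <;> linarith
  refine ⟨σ, habs, fun y hy => (h3 y hy ?_).le⟩
  have := (abs_le.1 (habs y hy y hy)).2
  have h4 := hY y hy
  simp_rw [← pow_two] at this
  have h5 : (n : ℝ) * ∑ i, y i ^ 2 ≤ n * 1 := by gcongr
  have h6 : (0 : ℝ) ≤ n := n.cast_nonneg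
  linarith

/-- Rounding of a real number towards zero. -/
noncomputable def roundToZero (x : ℝ) : ℤ := if 0 ≤ x then ⌊x⌋ else ⌈x⌉

lemma abs_roundToZero_le (x : ℝ) : |(roundToZero x : ℝ)| ≤ |x| := by
  unfold roundToZero
  split_ifs with h
  · rw [abs_of_nonneg h, abs_of_nonneg (by exact_mod_cast Int.floor_nonneg.2 h)]
    exact Int.floor_le x
  · have h' : x ≤ 0 := (not_le.1 h).le
    rw [abs_of_nonpos h', abs_of_nonpos (by exact_mod_cast Int.ceil_nonpos.2 h')]
    linarith [Int.le_ceil x]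

lemma abs_sub_roundToZero_le_one (x : ℝ) : |x - roundToZero x| ≤ 1 := by
  unfold roundToZero
  split_ifs with h
  · rw [abs_le]; constructor <;> linarith [Int.floor_le x, Int.lt_floor_add_one x]
  · rw [abs_le]; constructor <;> linarith [Int.le_ceil x, Int.ceil_lt_add_one x]

lemma abs_sub_roundToZero_le_abs (x : ℝ) : |x - roundToZero x| ≤ |x| := by
  have h1 := abs_roundToZero_le x
  unfold roundToZero at h1 ⊢
  split_ifs at h1 ⊢ with h
  · have : (0 : ℝ) ≤ ⌊x⌋ := by exact_mod_cast Int.floor_nonneg.2 h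
    rw [abs_of_nonneg h, abs_of_nonneg (by linarith [Int.floor_le x])]
    linarith
  · have h' : x ≤ 0 := (not_le.1 h).le
    have : (⌈x⌉ : ℝ) ≤ 0 := by exact_mod_cast Int.ceil_nonpos.2 h'
    rw [abs_of_nonpos h', abs_of_nonpos (by linarith [Int.le_ceil x])]
    linarith

lemma sq_roundToZero_le (x : ℝ) : (roundToZero x : ℝ) ^ 2 ≤ x ^ 2 :=
  sq_le_sq.2 (abs_roundToZero_le x)

/-- The integer points of the Euclidean ball of squared radius `m`. -/
noncomputable def intBall (N : ℕ) (m : ℝ) : Finset (Fin N → ℤ) :=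
  (Fintype.piFinset fun _ => Finset.Icc (-⌊m⌋) ⌊m⌋).filter fun v => ∑ i, (v i : ℝ) ^ 2 ≤ m

lemma mem_intBall {N : ℕ} {m : ℝ} {v : Fin N → ℤ} :
    v ∈ intBall N m ↔ ∑ i, (v i : ℝ) ^ 2 ≤ m := by
  simp only [intBall, Finset.mem_filter, Fintype.mem_piFinset, Finset.mem_Icc,
    and_iff_right_iff_imp]
  intro h i
  have h1 : (v i : ℝ) ^ 2 ≤ m :=
    (Finset.single_le_sum (f := fun i => (v i : ℝ) ^ 2) (fun i _ => sq_nonneg _)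
      (Finset.mem_univ i)).trans h
  have h2 : (|v i| : ℤ) ≤ ⌊m⌋ := by
    rw [Int.le_floor]
    refine le_trans ?_ h1
    have : |v i| ≤ v i ^ 2 := by
      rw [← sq_abs]; exact Int.le_self_sq _
    exact_mod_cast this
  exact abs_le.1 h2

lemma sum_pow_natAbs_le {r : ℝ} (hr : 0 ≤ r) (hr' : r ≤ 1 / 2) (M : ℕ) :
    ∑ j ∈ Finset.Icc (-(M : ℤ)) M, r ^ j.natAbs ≤ 1 + 4 * r := by
  have h : ∀ M : ℕ, ∑ j ∈ Finset.Icc (-(M : ℤ)) M, r ^ j.natAbs ≤ 1 + 4 * r - 4 * r ^ (M + 1) := by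
    intro M
    induction M with
    | zero => simp
    | succ M ih =>
      have : Finset.Icc (-((M + 1 : ℕ) : ℤ)) ((M + 1 : ℕ) : ℤ)
          = insert (-((M + 1 : ℕ) : ℤ)) (insert ((M + 1 : ℕ) : ℤ) (Finset.Icc (-(M : ℤ)) M)) := by
        ext j; simp; omega
      rw [this, Finset.sum_insert (by simp; omega), Finset.sum_insert (by simp)]
      have h1 : (-((M + 1 : ℕ) : ℤ)).natAbs = M + 1 := by omega
      have h2 : (((M + 1 : ℕ) : ℤ)).natAbs = M + 1 := by omega
      rw [h1, h2]
      have h3 : r ^ (M + 1 + 1) ≤ r ^ (M + 1) * (1 / 2) := by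
        rw [pow_succ r (M + 1)]; gcongr
      linarith
  have := h M
  have h' : 0 ≤ r ^ (M + 1) := by positivity
  linarith

lemma card_intBall_le {N : ℕ} {m t : ℝ} (hm : 0 ≤ m) (ht : Real.exp (-t) ≤ 1 / 2) :
    ((intBall N m).card : ℝ) ≤ Real.exp (t * m + 4 * N * Real.exp (-t)) := by
  obtain ⟨M, hM⟩ : ∃ M : ℕ, ⌊m⌋ = M := ⟨⌊m⌋.toNat, (Int.toNat_of_nonneg (Int.floor_nonneg.2 hm)).symm⟩
  have ht0 : 0 ≤ t := by
    by_contra! h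
    have := Real.one_lt_exp_iff.2 (neg_pos.2 h)
    linarith
  have h1 : ((intBall N m).card : ℝ) ≤ ∑ v ∈ Fintype.piFinset fun _ : Fin N => Finset.Icc (-⌊m⌋) ⌊m⌋,
      Real.exp (t * m) * ∏ i, Real.exp (-t) ^ (v i).natAbs := by
    rw [Finset.cast_card]
    refine (Finset.sum_le_sum fun v hv => ?_).trans
      (Finset.sum_le_sum_of_subset_of_nonneg (Finset.filter_subset _ _)
        fun _ _ _ => by positivity)
    have hv' := mem_intBall.1 hv
    simp_rw [← Real.exp_nat_mul]
    rw [← Real.exp_sum, ← Real.exp_add]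
    refine Real.one_le_exp ?_
    have h2 : ∑ i, ((v i).natAbs : ℝ) ≤ m := by
      refine le_trans (Finset.sum_le_sum fun i _ => ?_) hv'
      rw [Nat.cast_natAbs, Int.cast_abs, ← sq_abs]
      have : (|v i| : ℤ) ≤ |v i| ^ 2 := Int.le_self_sq _
      exact_mod_cast this
    rw [← Finset.sum_mul]
    nlinarith
  refine h1.trans ?_
  rw [← Finset.mul_sum, Finset.sum_prod_piFinset (Finset.Icc (-⌊m⌋) ⌊m⌋)
    (fun _ j => Real.exp (-t) ^ j.natAbs), Finset.prod_const, hM, Real.exp_add]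
  gcongr
  have h3 := sum_pow_natAbs_le (Real.exp_pos (-t)).le ht M
  calc _ ≤ Real.exp (4 * Real.exp (-t)) ^ (Finset.univ : Finset (Fin N)).card := by
        refine pow_le_pow_left₀ (Finset.sum_nonneg fun _ _ => by positivity) ?_ _
        linarith [Real.add_one_le_exp (4 * Real.exp (-t))]
    _ = _ := by
        rw [← Real.exp_nat_mul, Finset.card_fin]; ring_nf

/-- The integer ball of squared radius `4 s`, scaled into the unit ball. -/
noncomputable def gridBall (N : ℕ) (s : ℝ) : Finset (Fin N → ℝ) :=
  open Classical in (intBall N (4 * s)).image fun v i => (v i : ℝ) / (2 * √s)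

lemma sum_sq_le_one_of_mem_gridBall {N : ℕ} {s : ℝ} (hs : 0 < s) {y : Fin N → ℝ}
    (hy : y ∈ gridBall N s) : ∑ i, y i ^ 2 ≤ 1 := by
  classical
  obtain ⟨v, hv, rfl⟩ := Finset.mem_image.1 hy
  have := mem_intBall.1 hv
  simp_rw [div_pow]
  rw [← Finset.sum_div, div_le_one (by positivity), mul_pow, Real.sq_sqrt hs.le]
  linarith

lemma round_mem_gridBall {N : ℕ} {s : ℝ} (hs : 0 < s) {x : Fin N → ℝ} (hx : ∑ i, x i ^ 2 ≤ 1) :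
    (fun i => (roundToZero (2 * √s * x i) : ℝ) / (2 * √s)) ∈ gridBall N s := by
  classical
  refine Finset.mem_image.2 ⟨fun i => roundToZero (2 * √s * x i), mem_intBall.2 ?_, rfl⟩
  calc _ ≤ ∑ i, (2 * √s * x i) ^ 2 := Finset.sum_le_sum fun i _ => sq_roundToZero_le _
    _ = 4 * s * ∑ i, x i ^ 2 := by
      rw [Finset.mul_sum]
      refine Finset.sum_congr rfl fun i _ => ?_
      rw [mul_pow, mul_pow, Real.sq_sqrt hs.le]; ring
    _ ≤ 4 * s * 1 := by gcongr
    _ = _ := mul_one _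

lemma coarse_round_mem_gridBall {N : ℕ} {s : ℝ} (hs : 0 < s) {x : Fin N → ℝ}
    (hx : ∑ i, x i ^ 2 ≤ 1) :
    (fun i => (roundToZero (√s * x i) : ℝ) / √s) ∈ gridBall N s := by
  classical
  refine Finset.mem_image.2 ⟨fun i => 2 * roundToZero (√s * x i), mem_intBall.2 ?_, ?_⟩
  · calc _ = ∑ i, 4 * (roundToZero (√s * x i) : ℝ) ^ 2 := by
          refine Finset.sum_congr rfl fun i _ => ?_
          push_cast; ring
      _ ≤ ∑ i, 4 * (√s * x i) ^ 2 :=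
          Finset.sum_le_sum fun i _ => mul_le_mul_of_nonneg_left (sq_roundToZero_le _) (by norm_num)
      _ = 4 * s * ∑ i, x i ^ 2 := by
        rw [Finset.mul_sum]
        refine Finset.sum_congr rfl fun i _ => ?_
        rw [mul_pow, Real.sq_sqrt hs.le]; ring
      _ ≤ 4 * s * 1 := by gcongr
      _ = _ := mul_one _
  · funext i
    push_cast
    have : 0 < √s := Real.sqrt_pos.2 hs
    field_simp

lemma sum_gramSum_mul {n N : ℕ} (σ : Fin n → Fin N → Bool) (y u : Fin N → ℝ) :
    ∑ i, gramSum σ y i * u i = (∑ l, signSum (σ l) u * signSum (σ l) y) / √n := by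
  simp only [gramSum, signSum, Finset.sum_mul, Finset.sum_div]
  rw [Finset.sum_comm]
  refine Finset.sum_congr rfl fun l _ => Finset.sum_congr rfl fun i _ => ?_
  rw [Finset.mul_sum, Finset.mul_sum, Finset.sum_mul, Finset.sum_div]
  refine Finset.sum_congr rfl fun j _ => ?_
  ring

/-- If the pairings of a vector supported on at most `s` coordinates with grid points are small,
then so is the vector. -/
lemma sum_sq_le_of_forall_gridBall {N : ℕ} {s : ℝ} (hs : 0 < s) (ρ : Fin N → ℝ)
    (hsupp : ((Finset.univ.filter fun i => ρ i ≠ 0).card : ℝ) ≤ s)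
    (h : ∀ u ∈ gridBall N s, (∀ i, ρ i = 0 → u i = 0) → ∑ i, ρ i * u i ≤ 1 / 8) :
    ∑ i, ρ i ^ 2 ≤ 1 / 16 := by
  set Q := ∑ i, ρ i ^ 2
  have hQ : 0 ≤ Q := Finset.sum_nonneg fun i _ => sq_nonneg _
  rcases hQ.eq_or_lt with h0 | h0
  · rw [← h0]; norm_num
  set R := √Q
  have hR : 0 < R := Real.sqrt_pos.2 h0
  have hRQ : R ^ 2 = Q := Real.sq_sqrt hQ
  have hs' : 0 < √s := Real.sqrt_pos.2 hs
  let c : Fin N → ℝ := fun i => ρ i / R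
  let u : Fin N → ℝ := fun i => (roundToZero (2 * √s * c i) : ℝ) / (2 * √s)
  have hc : ∑ i, c i ^ 2 ≤ 1 := by
    simp only [c, div_pow]
    rw [← Finset.sum_div, hRQ, div_self h0.ne']
  have hu0 : ∀ i, ρ i = 0 → u i = 0 := by
    intro i hi
    simp [u, c, hi, roundToZero]
  have h1 := h u (round_mem_gridBall hs hc) hu0
  have h2 : ∑ i, ρ i * c i = R := by
    simp only [c]
    rw [eq_comm, ← mul_left_inj' hR.ne', Finset.sum_mul, ← pow_two, hRQ]
    refine Finset.sum_congr rfl fun i _ => ?_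
    field_simp
  have h3 : ∀ i, (c i - u i) ^ 2 ≤ if ρ i ≠ 0 then 1 / (4 * s) else 0 := by
    intro i
    split_ifs with hi
    · have e : c i - u i = (2 * √s * c i - roundToZero (2 * √s * c i)) / (2 * √s) := by
        simp only [u]; field_simp
      rw [e, div_pow, mul_pow, Real.sq_sqrt hs.le, show (2 : ℝ) ^ 2 = 4 by norm_num]
      gcongr
      rw [← sq_abs]
      exact pow_le_one₀ (abs_nonneg _) (abs_sub_roundToZero_le_one _)
    · have : ρ i = 0 := not_not.1 hi
      simp [hu0 i this, c, this]
  have h4 : ∑ i, (c i - u i) ^ 2 ≤ 1 / 4 := by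
    refine (Finset.sum_le_sum fun i _ => h3 i).trans ?_
    rw [← Finset.sum_filter, Finset.sum_const, nsmul_eq_mul]
    calc _ ≤ s * (1 / (4 * s)) := by gcongr
      _ = 1 / 4 := by field_simp
  have h5 : ∑ i, ρ i * (c i - u i) ≤ R / 2 := by
    have := Finset.sum_mul_sq_le_sq_mul_sq Finset.univ ρ (fun i => c i - u i)
    refine abs_le_of_sq_le_sq' ?_ (by positivity) |>.2
    calc _ ≤ Q * ∑ i, (c i - u i) ^ 2 := this
      _ ≤ Q * (1 / 4) := by gcongr
      _ = _ := by rw [← hRQ]; ring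
  have h6 : ∑ i, ρ i * c i = ∑ i, ρ i * u i + ∑ i, ρ i * (c i - u i) := by
    rw [← Finset.sum_add_distrib]
    exact Finset.sum_congr rfl fun i _ => by ring
  have : R ≤ 1 / 4 := by linarith
  rw [← hRQ]
  nlinarith

lemma sum_abs_rpow_sub_round_le {N : ℕ} {s q : ℝ} (hs : 0 < s) (hq : 2 < q) {x : Fin N → ℝ}
    (hx : ∑ i, x i ^ 2 ≤ 1) :
    ∑ i, |x i - (roundToZero (√s * x i) : ℝ) / √s| ^ q ≤ (1 / √s) ^ (q - 2) := by
  have hs' : 0 < √s := Real.sqrt_pos.2 hs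
  have h : ∀ i, |x i - (roundToZero (√s * x i) : ℝ) / √s| ^ q ≤ (1 / √s) ^ (q - 2) * x i ^ 2 := by
    intro i
    set d := |x i - (roundToZero (√s * x i) : ℝ) / √s|
    have e : d = |√s * x i - roundToZero (√s * x i)| / √s := by
      rw [← abs_of_pos hs', ← abs_div, abs_of_pos hs']
      simp only [d]
      congr 1
      field_simp
    have h1 : d ≤ 1 / √s := by
      rw [e]; gcongr; exact abs_sub_roundToZero_le_one _
    have h2 : d ≤ |x i| := by
      rw [e, div_le_iff₀ hs']
      refine (abs_sub_roundToZero_le_abs _).trans (le_of_eq ?_)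
      rw [abs_mul, abs_of_pos hs', mul_comm]
    have hd : 0 ≤ d := abs_nonneg _
    calc d ^ q = d ^ (q - 2) * d ^ 2 := by
          rw [← Real.rpow_natCast, ← Real.rpow_add_of_nonneg hd (by linarith) (by norm_num)]
          norm_num
      _ ≤ (1 / √s) ^ (q - 2) * |x i| ^ 2 := by
          gcongr
      _ = _ := by rw [sq_abs]
  refine (Finset.sum_le_sum fun i _ => h i).trans ?_
  rw [← Finset.mul_sum]
  exact mul_le_of_le_one_right (by positivity) hx

/-- The decomposition of a vector of the Euclidean unit ball into an element of the range of `σᵀ`,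
two vectors with small `ℓ_q`-norm, and one with small Euclidean norm. -/
lemma exists_decomposition {n N : ℕ} (hn : 0 < n) (hN : 0 < N) {q s : ℝ} (hq : 2 < q) (hs : 0 < s)
    {κ : ℝ} (hκ : κ = n / N / (512 * (8 * q) ^ (q / 2))) (σ : Fin n → Fin N → Bool)
    (h₁ : ∀ u ∈ gridBall N s, ∀ y ∈ gridBall N s,
        |∑ l, signSum (σ l) u * signSum (σ l) y - n * ∑ i, u i * y i| ≤ n / 8)
    (h₂ : ∀ y ∈ gridBall N s, ∑ i with y i = 0, mixedWeight q κ (gramSum σ y i) ≤ n / 16)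
    {x : Fin N → ℝ} (hx : ∑ i, x i ^ 2 ≤ 1) :
    ∃ (w : Fin n → ℝ) (a₁ a₂ b : Fin N → ℝ),
      (∀ i, x i = signSum (fun l => σ l i) w + a₁ i + a₂ i + b i) ∧
      ∑ i, |a₁ i| ^ q ≤ (1 / √s) ^ (q - 2) ∧
      ∑ i, |a₂ i| ^ q ≤ 32 * (8 * q) ^ (q / 2) * N * (1 / √n) ^ q ∧
      ∑ i, b i ^ 2 ≤ 1 / 4 := by
  classical
  have hD : 0 < (8 * q) ^ (q / 2) := by positivity
  have hn' : (0 : ℝ) < n := by exact_mod_cast hn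
  have hN' : (0 : ℝ) < N := by exact_mod_cast hN
  have hκ0 : 0 < κ := by rw [hκ]; positivity
  have hsn : 0 < √(n : ℝ) := Real.sqrt_pos.2 hn'
  have hsn2 : √(n : ℝ) ^ 2 = n := Real.sq_sqrt hn'.le
  have hs' : 0 < √s := Real.sqrt_pos.2 hs
  let y : Fin N → ℝ := fun i => (roundToZero (√s * x i) : ℝ) / √s
  have hy : y ∈ gridBall N s := coarse_round_mem_gridBall hs hx
  let g := gramSum σ y
  let z : Fin N → ℝ := fun i => g i / √n
  let ρ : Fin N → ℝ := fun i => if y i = 0 then 0 else z i - y i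
  have hρ : ∑ i, ρ i ^ 2 ≤ 1 / 16 := by
    refine sum_sq_le_of_forall_gridBall hs ρ ?_ ?_
    · rw [Finset.cast_card]
      calc ∑ i with ρ i ≠ 0, (1 : ℝ) ≤ ∑ i with ρ i ≠ 0, (roundToZero (√s * x i) : ℝ) ^ 2 := by
            refine Finset.sum_le_sum fun i hi => ?_
            have h0 : roundToZero (√s * x i) ≠ 0 := by
              intro h0
              simp [ρ, y, h0] at hi
            have : (1 : ℤ) ≤ roundToZero (√s * x i) ^ 2 := by
              have := sq_pos_of_ne_zero h0
              omega
            exact_mod_cast this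
        _ ≤ ∑ i, (roundToZero (√s * x i) : ℝ) ^ 2 :=
            Finset.sum_le_sum_of_subset_of_nonneg (Finset.subset_univ _) fun _ _ _ => sq_nonneg _
        _ ≤ ∑ i, (√s * x i) ^ 2 := Finset.sum_le_sum fun i _ => sq_roundToZero_le _
        _ = s * ∑ i, x i ^ 2 := by
            rw [Finset.mul_sum]
            refine Finset.sum_congr rfl fun i _ => ?_
            rw [mul_pow, Real.sq_sqrt hs.le]
        _ ≤ s * 1 := by gcongr
        _ = s := mul_one s
    · intro u hu hu0
      have e1 : ∑ i, ρ i * u i = ∑ i, z i * u i - ∑ i, u i * y i := by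
        rw [← Finset.sum_sub_distrib]
        refine Finset.sum_congr rfl fun i _ => ?_
        by_cases hi : y i = 0
        · rw [hu0 i (by simp [ρ, hi])]; ring
        · simp only [ρ, if_neg hi]; ring
      have e2 : ∑ i, z i * u i = (∑ l, signSum (σ l) u * signSum (σ l) y) / n := by
        have := sum_gramSum_mul σ y u
        calc _ = (∑ i, g i * u i) / √n := by
              rw [Finset.sum_div]; exact Finset.sum_congr rfl fun i _ => by simp only [z]; ring
          _ = _ := by rw [this, div_div, ← pow_two, hsn2]
      have e3 := (abs_le.1 (h₁ u hu y hy)).2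
      rw [e1, e2, sub_le_iff_le_add, div_le_iff₀ hn']
      linarith
  have hψ := h₂ y hy
  refine ⟨fun l => signSum (σ l) y / √n / √n, fun i => x i - y i,
    fun i => if y i = 0 ∧ κ * |g i| ^ q ≤ g i ^ 2 then -z i else 0,
    fun i => -ρ i + if y i = 0 ∧ ¬ κ * |g i| ^ q ≤ g i ^ 2 then -z i else 0, ?_, ?_, ?_, ?_⟩
  · intro i
    have : signSum (fun l => σ l i) (fun l => signSum (σ l) y / √n / √n) = z i := by
      simp only [z, g, gramSum, signSum, Finset.sum_div, mul_div_assoc]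
    rw [this]
    by_cases hi : y i = 0 <;> by_cases hi' : κ * |g i| ^ q ≤ g i ^ 2 <;> simp [hi, hi', ρ] <;> ring
  · exact sum_abs_rpow_sub_round_le hs hq hx
  · have h3 : ∀ i, κ * |if y i = 0 ∧ κ * |g i| ^ q ≤ g i ^ 2 then -z i else 0| ^ q
        ≤ if y i = 0 then mixedWeight q κ (g i) * (1 / √n) ^ q else 0 := by
      intro i
      have hm : 0 ≤ mixedWeight q κ (g i) := le_min (by positivity) (sq_nonneg _)
      by_cases hi : y i = 0
      · by_cases hi' : κ * |g i| ^ q ≤ g i ^ 2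
        · simp only [hi, hi', and_self, if_true, mixedWeight, min_eq_left, z, abs_neg, abs_div,
            abs_of_pos hsn]
          rw [div_eq_mul_one_div, Real.mul_rpow (abs_nonneg _) (by positivity), mul_assoc]
        · simp only [hi, hi', and_false, if_true, if_false, abs_zero]
          rw [Real.zero_rpow (by linarith), mul_zero]
          positivity
      · simp only [hi, false_and, if_false, abs_zero]
        rw [Real.zero_rpow (by linarith), mul_zero]
    have h4 : κ * ∑ i, |if y i = 0 ∧ κ * |g i| ^ q ≤ g i ^ 2 then -z i else 0| ^ q
        ≤ n / 16 * (1 / √n) ^ q := by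
      rw [Finset.mul_sum]
      refine (Finset.sum_le_sum fun i _ => h3 i).trans ?_
      rw [← Finset.sum_filter, ← Finset.sum_mul]
      gcongr
    rw [← mul_le_mul_iff_right₀ hκ0]
    refine h4.trans (le_of_eq ?_)
    rw [hκ]
    field_simp
    norm_num
  · have h3 : ∀ i, (-ρ i + if y i = 0 ∧ ¬ κ * |g i| ^ q ≤ g i ^ 2 then -z i else 0) ^ 2
        ≤ ρ i ^ 2 + if y i = 0 then mixedWeight q κ (g i) / n else 0 := by
      intro i
      have hm : 0 ≤ mixedWeight q κ (g i) := le_min (by positivity) (sq_nonneg _)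
      by_cases hi : y i = 0
      · by_cases hi' : κ * |g i| ^ q ≤ g i ^ 2
        · simp only [hi, hi', ρ, not_true, and_false, if_true, if_false]
          have : 0 ≤ mixedWeight q κ (g i) / n := by positivity
          linarith
        · simp only [hi, hi', ρ, not_false_iff, and_self, if_true, mixedWeight,
            min_eq_right (not_le.1 hi').le, z]
          have : (-0 + -(g i / √n)) ^ 2 = g i ^ 2 / n := by
            rw [neg_zero, zero_add, neg_sq, div_pow, hsn2]
          linarith
      · simp [hi]
    refine (Finset.sum_le_sum fun i _ => h3 i).trans ?_
    rw [Finset.sum_add_distrib, ← Finset.sum_filter, ← Finset.sum_div]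
    have : (∑ i with y i = 0, mixedWeight q κ (g i)) / n ≤ 1 / 16 := by
      rw [div_le_iff₀ hn']; linarith
    linarith

lemma exists_scale {q : ℝ} (hq : 2 < q) :
    ∃ K : ℝ, 0 < K ∧ ∀ n N : ℕ, 393216 ≤ n → n ≤ N → ∃ s : ℝ, 0 < s ∧
      3 * ((gridBall N s).card : ℝ) ^ 2 * Real.exp (-(n / 98304)) < 1 ∧
      (1 / √s) ^ (q - 2) = K * N * (1 / √n) ^ q := by
  set δ : ℝ := 1 / 393216 / (2 * q + 12) with hδ
  have hδ0 : 0 < δ := by positivity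
  have hδ1 : δ ≤ 1 / 2 := by
    rw [hδ, div_le_iff₀ (by linarith)]; linarith
  have hδq : δ * (2 * q + 12) = 1 / 393216 := by rw [hδ]; field_simp
  have hq2 : 0 < q - 2 := by linarith
  refine ⟨(1 / δ) ^ (q - 2), by positivity, fun n N hn hnN => ?_⟩
  have hn' : (0 : ℝ) < n := by exact_mod_cast (by omega : 0 < n)
  have hN' : (0 : ℝ) < N := by exact_mod_cast (by omega : 0 < N)
  set a : ℝ := 2 / (q - 2) with ha
  have ha0 : 0 < a := by positivity
  have haq : (1 + a) / a = q / 2 := by rw [ha]; field_simp; ring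
  set x : ℝ := N / n with hx
  have hx1 : 1 ≤ x := by
    rw [hx, one_le_div hn']; exact_mod_cast hnN
  have hx0 : 0 < x := by linarith
  set s : ℝ := δ ^ 2 * n * x ^ (-a) with hs
  have hs0 : 0 < s := by positivity
  refine ⟨s, hs0, ?_, ?_⟩
  · set t : ℝ := Real.log (x ^ (1 + a) / δ ^ 2) with ht
    have hexp : Real.exp (-t) = δ ^ 2 * x ^ (-(1 + a)) := by
      rw [ht, Real.exp_neg, Real.exp_log (by positivity), inv_div, Real.rpow_neg hx0.le]
      rfl
    have hxa : x ^ (-(1 + a)) ≤ 1 := Real.rpow_le_one_of_one_le_of_nonpos hx1 (by linarith)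
    have hxa' : x ^ (-a) ≤ 1 := Real.rpow_le_one_of_one_le_of_nonpos hx1 (by linarith)
    have ht2 : Real.exp (-t) ≤ 1 / 2 := by
      rw [hexp]
      calc δ ^ 2 * x ^ (-(1 + a)) ≤ δ ^ 2 * 1 := by gcongr
        _ ≤ 1 / 2 := by nlinarith
    have hNt : N * Real.exp (-t) ≤ δ ^ 2 * n := by
      have : (N : ℝ) = n * x := by rw [hx]; field_simp
      rw [hexp, this]
      calc n * x * (δ ^ 2 * x ^ (-(1 + a))) = δ ^ 2 * n * (x ^ (1 : ℝ) * x ^ (-(1 + a))) := by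
            rw [Real.rpow_one]; ring
        _ = δ ^ 2 * n * x ^ (-a) := by rw [← Real.rpow_add hx0]; ring_nf
        _ ≤ δ ^ 2 * n * 1 := by gcongr
        _ = _ := mul_one _
    have hst : t * s ≤ n * (δ ^ 2 * (q / 2) + 2 * δ) := by
      have h1 : t = (1 + a) * Real.log x + 2 * Real.log (1 / δ) := by
        rw [ht, Real.log_div (by positivity) (by positivity), Real.log_rpow hx0, Real.log_pow,
          one_div, Real.log_inv]
        push_cast; ring
      have h2 : Real.log x ≤ x ^ a / a := Real.log_le_rpow_div hx0.le ha0
      have h3 : Real.log (1 / δ) ≤ 1 / δ := Real.log_le_self (by positivity)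
      have h4 : x ^ (-a) * x ^ a = 1 := by rw [← Real.rpow_add hx0]; simp
      calc t * s ≤ ((1 + a) * (x ^ a / a) + 2 * (1 / δ)) * s := by rw [h1]; gcongr
        _ = δ ^ 2 * n * ((1 + a) / a) * (x ^ (-a) * x ^ a) + 2 * δ * n * x ^ (-a) := by
            rw [hs]; field_simp
        _ ≤ δ ^ 2 * n * ((1 + a) / a) * 1 + 2 * δ * n * 1 := by rw [h4]; gcongr
        _ = _ := by rw [haq]; ring
    have hcard : ((gridBall N s).card : ℝ) ≤ Real.exp (n / 393216) := by
      classical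
      have h1 : ((gridBall N s).card : ℝ) ≤ (intBall N (4 * s)).card := by
        exact_mod_cast Finset.card_image_le
      refine h1.trans ((card_intBall_le (t := t) (by positivity) ht2).trans ?_)
      gcongr
      have h2 : t * (4 * s) + 4 * N * Real.exp (-t)
          ≤ n * (4 * δ ^ 2 * (q / 2) + 8 * δ + 4 * δ ^ 2) := by nlinarith
      refine h2.trans ?_
      rw [div_eq_mul_one_div (n : ℝ), ← hδq]
      refine mul_le_mul_of_nonneg_left ?_ hn'.le
      have h3 : δ ^ 2 ≤ δ := by nlinarith
      nlinarith [mul_le_mul_of_nonneg_right h3 (by linarith : 0 ≤ 2 * q + 4)]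
    have h3 : (3 : ℝ) < Real.exp (n / 196608) := by
      have h2 : (2 : ℝ) ≤ n / 196608 := by
        rw [le_div_iff₀ (by norm_num)]; norm_num; exact_mod_cast hn
      have := Real.add_one_lt_exp (x := (n : ℝ) / 196608) (by positivity)
      linarith
    calc _ ≤ 3 * Real.exp (n / 393216) ^ 2 * Real.exp (-(n / 98304)) := by gcongr
      _ = 3 * Real.exp (-(n / 196608)) := by
        rw [← Real.exp_nat_mul, mul_assoc, ← Real.exp_add]; push_cast; ring_nf
      _ < Real.exp (n / 196608) * Real.exp (-(n / 196608)) := by gcongr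
      _ = 1 := by rw [← Real.exp_add]; simp
  · have h1 : 1 / √s = 1 / δ * (1 / √n) * x ^ (a / 2) := by
      rw [hs, Real.sqrt_mul (by positivity), Real.sqrt_mul (by positivity), Real.sqrt_sq hδ0.le,
        Real.sqrt_eq_rpow (x ^ (-a)), ← Real.rpow_mul hx0.le,
        show -a * (1 / 2) = -(a / 2) by ring, Real.rpow_neg hx0.le]
      field_simp
    have h2 : a / 2 * (q - 2) = 1 := by rw [ha]; field_simp
    rw [h1, Real.mul_rpow (by positivity) (by positivity), Real.mul_rpow (by positivity)
      (by positivity), ← Real.rpow_mul hx0.le, h2, Real.rpow_one]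
    have h3 : (1 / √(n : ℝ)) ^ q = (1 / √(n : ℝ)) ^ (q - 2) * (1 / n) := by
      have : (1 / n : ℝ) = (1 / √(n : ℝ)) ^ (2 : ℝ) := by
        rw [Real.rpow_two, div_pow, Real.sq_sqrt hn'.le, one_pow]
      rw [this, ← Real.rpow_add (by positivity)]
      congr 1; ring
    rw [h3, hx]
    ring

/-- The `ℓ_q`-norm of a real vector. -/
noncomputable def lqNorm {N : ℕ} (q : ℝ) (x : Fin N → ℝ) : ℝ := (∑ i, |x i| ^ q) ^ (1 / q)

lemma lqNorm_add_le {N : ℕ} {q : ℝ} (hq : 1 ≤ q) (x y : Fin N → ℝ) :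
    lqNorm q (x + y) ≤ lqNorm q x + lqNorm q y :=
  Real.Lp_add_le Finset.univ x y hq

lemma lqNorm_smul {N : ℕ} {q : ℝ} (hq : 0 < q) {r : ℝ} (hr : 0 ≤ r) (x : Fin N → ℝ) :
    lqNorm q (r • x) = r * lqNorm q x := by
  unfold lqNorm
  have : ∀ i, |(r • x) i| ^ q = r ^ q * |x i| ^ q := fun i => by
    rw [Pi.smul_apply, smul_eq_mul, abs_mul, abs_of_nonneg hr, Real.mul_rpow hr (abs_nonneg _)]
  simp_rw [this]
  rw [← Finset.mul_sum, Real.mul_rpow (by positivity) (Finset.sum_nonneg fun _ _ => by positivity),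
    ← Real.rpow_mul hr, mul_one_div_cancel hq.ne', Real.rpow_one]

lemma lqNorm_le_of_sum_le {N : ℕ} {q : ℝ} (hq : 0 < q) {x : Fin N → ℝ} {A B : ℝ} (hA : 0 ≤ A)
    (hB : 0 ≤ B) (h : ∑ i, |x i| ^ q ≤ A * B ^ q) : lqNorm q x ≤ A ^ (1 / q) * B := by
  have h0 : 0 ≤ ∑ i, |x i| ^ q := Finset.sum_nonneg fun _ _ => by positivity
  have := Real.rpow_le_rpow h0 h (by positivity : 0 ≤ 1 / q)
  rwa [Real.mul_rpow hA (by positivity), ← Real.rpow_mul hB, mul_one_div_cancel hq.ne',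
    Real.rpow_one] at this

lemma lqNorm_le_one {N : ℕ} {q : ℝ} (hq : 2 ≤ q) {x : Fin N → ℝ} (hx : ∑ i, x i ^ 2 ≤ 1) :
    lqNorm q x ≤ 1 := by
  refine Real.rpow_le_one (Finset.sum_nonneg fun _ _ => by positivity) ?_ (by positivity)
  refine le_trans (Finset.sum_le_sum fun i _ => ?_) hx
  have h1 : x i ^ 2 ≤ 1 :=
    (Finset.single_le_sum (f := fun i => x i ^ 2) (fun i _ => sq_nonneg _)
      (Finset.mem_univ i)).trans hx
  rw [← sq_abs, ← Real.rpow_two]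
  exact Real.rpow_le_rpow_of_exponent_ge_of_imp (abs_nonneg _)
    ((sq_le_one_iff_abs_le_one _).1 h1) hq (fun _ h => by linarith)

/-- Approximation by the range of a sign matrix up to a vector of half the Euclidean norm. -/
lemma exists_half_approximation {q : ℝ} (hq : 2 < q) :
    ∃ K : ℝ, 0 < K ∧ ∀ n N : ℕ, 393216 ≤ n → n ≤ N → ∃ σ : Fin n → Fin N → Bool,
      ∀ x : Fin N → ℝ, ∑ i, x i ^ 2 ≤ 1 → ∃ (w : Fin n → ℝ) (a b : Fin N → ℝ),
        (∀ i, x i = signSum (fun l => σ l i) w + a i + b i) ∧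
        lqNorm q a ≤ K * ((N : ℝ) ^ (1 / q) * (1 / √n)) ∧ ∑ i, b i ^ 2 ≤ 1 / 4 := by
  obtain ⟨K, hK, H⟩ := exists_scale hq
  have hD : 0 < (8 * q) ^ (q / 2) := by positivity
  refine ⟨K ^ (1 / q) + (32 * (8 * q) ^ (q / 2)) ^ (1 / q), by positivity, fun n N hn hnN => ?_⟩
  obtain ⟨s, hs, hcard, hsK⟩ := H n N hn hnN
  obtain ⟨σ, h1, h2⟩ := exists_good_signs (by omega : 0 < n) (by omega : 0 < N)
    (by linarith : 0 < q) rfl (gridBall N s) (fun y hy => sum_sq_le_one_of_mem_gridBall hs hy) hcard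
  refine ⟨σ, fun x hx => ?_⟩
  obtain ⟨w, a₁, a₂, b, hx', ha₁, ha₂, hb⟩ := exists_decomposition (by omega : 0 < n)
    (by omega : 0 < N) hq hs rfl σ h1 h2 hx
  refine ⟨w, a₁ + a₂, b, fun i => by rw [hx' i, Pi.add_apply]; ring, ?_, hb⟩
  have hN0 : (0 : ℝ) ≤ N := N.cast_nonneg
  have e1 := lqNorm_le_of_sum_le (by linarith) (by positivity) (by positivity) (ha₁.trans hsK.le)
  have e2 := lqNorm_le_of_sum_le (by linarith) (by positivity) (by positivity) ha₂
  rw [Real.mul_rpow (by positivity) hN0] at e1 e2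
  refine (lqNorm_add_le (by linarith) _ _).trans ?_
  linarith

/-- Every vector of the Euclidean unit ball is close in `ℓ_q` to the range of a sign matrix. -/
lemma exists_approximation {q : ℝ} (hq : 2 < q) :
    ∃ K : ℝ, 0 < K ∧ ∀ n N : ℕ, 393216 ≤ n → n ≤ N → ∃ σ : Fin n → Fin N → Bool,
      ∀ x : Fin N → ℝ, ∑ i, x i ^ 2 ≤ 1 → ∃ w : Fin n → ℝ,
        lqNorm q (fun i => x i - signSum (fun l => σ l i) w)
          ≤ K * ((N : ℝ) ^ (1 / q) * (1 / √n)) := by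
  obtain ⟨K, hK, H⟩ := exists_half_approximation hq
  refine ⟨3 * K, by positivity, fun n N hn hnN => ?_⟩
  obtain ⟨σ, hσ⟩ := H n N hn hnN
  have hn' : (0 : ℝ) < n := by exact_mod_cast (by omega : 0 < n)
  have hN' : (0 : ℝ) < N := by exact_mod_cast (by omega : 0 < N)
  set ε : ℝ := (N : ℝ) ^ (1 / q) * (1 / √n)
  have hε : 0 < ε := by positivity
  have hiter : ∀ j : ℕ, ∀ x : Fin N → ℝ, ∑ i, x i ^ 2 ≤ 1 → ∃ w : Fin n → ℝ,
      lqNorm q (fun i => x i - signSum (fun l => σ l i) w) ≤ 2 * K * ε + (1 / 2) ^ j := by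
    intro j
    induction j with
    | zero =>
      intro x hx
      refine ⟨0, ?_⟩
      have : lqNorm q x ≤ 1 := lqNorm_le_one hq.le hx
      simp only [signSum, Pi.zero_apply, mul_zero, Finset.sum_const_zero, sub_zero, pow_zero]
      have : 0 < 2 * K * ε := by positivity
      linarith
    | succ j ih =>
      intro x hx
      obtain ⟨w, a, b, hx', ha, hb⟩ := hσ x hx
      have hb' : ∑ i, ((2 : ℝ) • b) i ^ 2 ≤ 1 := by
        simp only [Pi.smul_apply, smul_eq_mul, mul_pow]
        rw [← Finset.mul_sum]
        linarith
      obtain ⟨w', hw'⟩ := ih _ hb'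
      refine ⟨w + (1 / 2 : ℝ) • w', ?_⟩
      have e : (fun i => x i - signSum (fun l => σ l i) (w + (1 / 2 : ℝ) • w'))
          = a + (1 / 2 : ℝ) • fun i => ((2 : ℝ) • b) i - signSum (fun l => σ l i) w' := by
        funext i
        have : signSum (fun l => σ l i) (w + (1 / 2 : ℝ) • w')
            = signSum (fun l => σ l i) w + 1 / 2 * signSum (fun l => σ l i) w' := by
          simp only [signSum, Pi.add_apply, Pi.smul_apply, smul_eq_mul, Finset.mul_sum]
          rw [← Finset.sum_add_distrib]
          exact Finset.sum_congr rfl fun l _ => by ring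
        rw [this, hx' i]
        simp only [Pi.add_apply, Pi.smul_apply, smul_eq_mul]
        ring
      rw [e]
      refine (lqNorm_add_le (by linarith) _ _).trans ?_
      rw [lqNorm_smul (by linarith) (by norm_num), pow_succ]
      linarith
  obtain ⟨j, hj⟩ := exists_pow_lt_of_lt_one (by positivity : 0 < K * ε)
    (by norm_num : (1 / 2 : ℝ) < 1)
  refine ⟨σ, fun x hx => ?_⟩
  obtain ⟨w, hw⟩ := hiter j x hx
  exact ⟨w, by linarith⟩

section Kolmogorov

variable {X Y : Type*} [NormedAddCommGroup X] [NormedSpace ℂ X]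
  [NormedAddCommGroup Y] [NormedSpace ℂ Y] (T : X →L[ℂ] Y) (k : ℕ)

lemma kolmogorovNumber_nonneg : 0 ≤ kolmogorovNumber T k :=
  Real.sInf_nonneg fun _ ⟨_, _, hr⟩ => hr ▸
    Real.iSup_nonneg fun _ => Real.iInf_nonneg fun _ => norm_nonneg _

variable {T k} in
lemma kolmogorovNumber_le {L : Submodule ℂ Y} (hL : Module.rank ℂ L < (k : Cardinal)) {M : ℝ}
    (h : ∀ x : X, ‖x‖ ≤ 1 → ∃ z ∈ L, ‖T x - z‖ ≤ M) : kolmogorovNumber T k ≤ M := by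
  have hbdd : BddBelow { r | ∃ L : Submodule ℂ Y, Module.rank ℂ L < (k : Cardinal) ∧
      r = ⨆ x : {x : X // ‖x‖ ≤ 1}, ⨅ z : L, ‖T x.1 - (z : Y)‖ } :=
    ⟨0, fun _ ⟨_, _, hr⟩ => hr ▸
      Real.iSup_nonneg fun _ => Real.iInf_nonneg fun _ => norm_nonneg _⟩
  refine (csInf_le hbdd ⟨L, hL, rfl⟩).trans ?_
  have : Nonempty {x : X // ‖x‖ ≤ 1} := ⟨⟨0, by simp⟩⟩
  refine ciSup_le fun x => ?_
  obtain ⟨z, hz, hM⟩ := h x.1 x.2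
  exact ciInf_le_of_le ⟨0, fun _ ⟨_, hr⟩ => hr ▸ norm_nonneg _⟩ (⟨z, hz⟩ : L) hM

end Kolmogorov

@[simp]
lemma lpId_apply {p₁ p₂ : ℝ≥0∞} [Fact (1 ≤ p₁)] [Fact (1 ≤ p₂)] {N : ℕ}
    (x : PiLp p₁ (fun _ : Fin N => ℂ)) (i : Fin N) : lpId p₁ p₂ N x i = x i := rfl

lemma sum_norm_sq_le_one {p : ℝ≥0∞} [Fact (1 ≤ p)] (hp : p < 2) {N : ℕ}
    {x : PiLp p (fun _ : Fin N => ℂ)} (hx : ‖x‖ ≤ 1) : ∑ i, ‖x i‖ ^ 2 ≤ 1 := by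
  have hp1 : 1 ≤ p := Fact.out
  have hpt : p ≠ ∞ := (hp.trans (by simp)).ne
  have hp0 : 1 ≤ p.toReal := by
    simpa using ENNReal.toReal_mono hpt hp1
  have hp2 : p.toReal ≤ 2 := by
    simpa using ENNReal.toReal_mono (by simp) hp.le
  rw [PiLp.norm_eq_sum (by linarith)] at hx
  have h0 : 0 ≤ ∑ i, ‖x i‖ ^ p.toReal := Finset.sum_nonneg fun _ _ => by positivity
  have hsum : ∑ i, ‖x i‖ ^ p.toReal ≤ 1 := by
    by_contra! h
    exact absurd (Real.one_lt_rpow h (by positivity : 0 < 1 / p.toReal)) hx.not_gt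
  refine le_trans (Finset.sum_le_sum fun i _ => ?_) hsum
  have h1 : ‖x i‖ ^ p.toReal ≤ 1 :=
    (Finset.single_le_sum (f := fun i => ‖x i‖ ^ p.toReal) (fun i _ => by positivity)
      (Finset.mem_univ i)).trans hsum
  have h2 : ‖x i‖ ≤ 1 := by
    by_contra! h
    exact absurd (Real.one_lt_rpow h (by linarith : 0 < p.toReal)) h1.not_gt
  rw [← Real.rpow_two]
  exact Real.rpow_le_rpow_of_exponent_ge_of_imp (norm_nonneg _) h2 hp2 (fun _ h => by norm_num at h)

lemma norm_le_lqNorm_re_add_im {p : ℝ≥0∞} [Fact (1 ≤ p)] (hp : p ≠ ∞) {N : ℕ}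
    (x : PiLp p (fun _ : Fin N => ℂ)) :
    ‖x‖ ≤ lqNorm p.toReal (fun i => (x i).re) + lqNorm p.toReal (fun i => (x i).im) := by
  have hp0 : 1 ≤ p.toReal := by
    simpa using ENNReal.toReal_mono hp (Fact.out : 1 ≤ p)
  rw [PiLp.norm_eq_sum (by linarith)]
  refine le_trans ?_ (Real.Lp_add_le_of_nonneg (s := Finset.univ) hp0
    (fun i _ => abs_nonneg (x i).re) (fun i _ => abs_nonneg (x i).im))
  gcongr with i
  exact Complex.norm_le_abs_re_add_abs_im _

lemma kolmogorovNumber_lpId_eq_zero {p₁ p₂ : ℝ≥0∞} [Fact (1 ≤ p₁)] [Fact (1 ≤ p₂)] {N k : ℕ}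
    (hk : N < k) : kolmogorovNumber (lpId p₁ p₂ N) k = 0 := by
  refine le_antisymm (kolmogorovNumber_le (L := ⊤) ?_ fun x _ => ⟨lpId p₁ p₂ N x, by simp⟩)
    (kolmogorovNumber_nonneg _ _)
  rw [rank_top, (WithLp.linearEquiv p₂ ℂ (Fin N → ℂ)).rank_eq, rank_fin_fun]
  exact_mod_cast hk

lemma kolmogorovNumber_lpId_le_one {p₁ p₂ : ℝ≥0∞} [Fact (1 ≤ p₁)] [Fact (1 ≤ p₂)] (h₁ : p₁ < 2)
    (h₂ : 2 < p₂) (h₃ : p₂ ≠ ∞) {N k : ℕ} (hk : 1 ≤ k) :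
    kolmogorovNumber (lpId p₁ p₂ N) k ≤ 1 := by
  refine kolmogorovNumber_le (L := ⊥) ?_ fun x hx => ⟨0, by simp, ?_⟩
  · rw [rank_bot]; exact_mod_cast hk
  have hq : 2 ≤ p₂.toReal := by simpa using ENNReal.toReal_mono h₃ h₂.le
  have hle : lqNorm p₂.toReal (fun i => ‖x i‖) ≤ 1 := lqNorm_le_one hq (sum_norm_sq_le_one h₁ hx)
  rw [sub_zero, PiLp.norm_eq_sum (by linarith)]
  simpa [lqNorm] using hle

/-- The complex-linear map given by a sign matrix. -/
noncomputable def signMap (p : ℝ≥0∞) {n N : ℕ} (σ : Fin n → Fin N → Bool) :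
    (Fin n → ℂ) →ₗ[ℂ] PiLp p (fun _ : Fin N => ℂ) :=
  (WithLp.linearEquiv p ℂ (Fin N → ℂ)).symm.toLinearMap ∘ₗ
    Matrix.toLin' (Matrix.of fun i l => (boolSign (σ l i) : ℂ))

lemma signMap_apply {p : ℝ≥0∞} {n N : ℕ} (σ : Fin n → Fin N → Bool) (u v : Fin n → ℝ)
    (i : Fin N) : signMap p σ (fun l => ⟨u l, v l⟩) i
      = ⟨signSum (fun l => σ l i) u, signSum (fun l => σ l i) v⟩ := by
  change ∑ l, (boolSign (σ l i) : ℂ) * ⟨u l, v l⟩ = _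
  apply Complex.ext <;> simp [signSum]

lemma exists_kolmogorovNumber_lpId_le {p₁ p₂ : ℝ≥0∞} [Fact (1 ≤ p₁)] [Fact (1 ≤ p₂)] (h₁ : p₁ < 2)
    (h₂ : 2 < p₂) (h₃ : p₂ ≠ ∞) : ∃ K : ℝ, 0 < K ∧ ∀ n N : ℕ, 393216 ≤ n → n ≤ N →
      kolmogorovNumber (lpId p₁ p₂ N) (n + 1) ≤ K * ((N : ℝ) ^ (1 / p₂.toReal) * (1 / √n)) := by
  have hq : 2 < p₂.toReal := by
    simpa using (ENNReal.toReal_lt_toReal (by simp) h₃).2 h₂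
  obtain ⟨K, hK, H⟩ := exists_approximation hq
  refine ⟨2 * K, by positivity, fun n N hn hnN => ?_⟩
  obtain ⟨σ, hσ⟩ := H n N hn hnN
  refine kolmogorovNumber_le (L := LinearMap.range (signMap p₂ σ)) ?_ fun x hx => ?_
  · calc Module.rank ℂ (LinearMap.range (signMap p₂ σ)) ≤ Module.rank ℂ (Fin n → ℂ) :=
          rank_range_le _
      _ = n := rank_fin_fun n
      _ < (n + 1 : ℕ) := by exact_mod_cast n.lt_succ_self
  · have hx2 := sum_norm_sq_le_one h₁ hx
    obtain ⟨u, hu⟩ := hσ (fun i => (x i).re) (le_trans (Finset.sum_le_sum fun i _ =>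
      sq_le_sq.2 (by simpa using Complex.abs_re_le_norm (x i))) hx2)
    obtain ⟨v, hv⟩ := hσ (fun i => (x i).im) (le_trans (Finset.sum_le_sum fun i _ =>
      sq_le_sq.2 (by simpa using Complex.abs_im_le_norm (x i))) hx2)
    refine ⟨signMap p₂ σ fun l => ⟨u l, v l⟩, LinearMap.mem_range_self _ _,
      (norm_le_lqNorm_re_add_im h₃ _).trans ?_⟩
    simp only [PiLp.sub_apply, lpId_apply, signMap_apply, Complex.sub_re, Complex.sub_im]
    linarith

/-- If `1 ≤ p₁ < 2 < p₂ < ∞`, then `d_k(id : ℓ_{p₁}^N → ℓ_{p₂}^N) ≤ C` for `k ≤ N^{2/p₂}`,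
`d_k ≤ C N^{1/p₂} k^{-1/2}` for `N^{2/p₂} < k ≤ N`, and `d_k = 0` for `k > N`. -/
theorem stmt7 (p₁ p₂ : ℝ≥0∞) [Fact (1 ≤ p₁)] [Fact (1 ≤ p₂)]
    (h₁ : p₁ < 2) (h₂ : 2 < p₂) (h₃ : p₂ < ∞) :
    ∃ C : ℝ, 0 < C ∧
      ∀ N k : ℕ, 1 ≤ k →
        ((k : ℝ) ≤ (N : ℝ) ^ (2 * (p₂⁻¹).toReal) →
          kolmogorovNumber (lpId p₁ p₂ N) k ≤ C) ∧
        ((N : ℝ) ^ (2 * (p₂⁻¹).toReal) < (k : ℝ) → k ≤ N →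
          kolmogorovNumber (lpId p₁ p₂ N) k
            ≤ C * (N : ℝ) ^ ((p₂⁻¹).toReal) * (k : ℝ) ^ (-(1/2) : ℝ)) ∧
        (N < k → kolmogorovNumber (lpId p₁ p₂ N) k = 0) := by
  obtain ⟨K, hK, H⟩ := exists_kolmogorovNumber_lpId_le (p₁ := p₁) h₁ h₂ h₃.ne
  refine ⟨2 * K + 1000, by positivity, fun N k hk => ⟨fun _ => ?_, fun _ hkN => ?_,
    kolmogorovNumber_lpId_eq_zero⟩⟩
  · exact (kolmogorovNumber_lpId_le_one h₁ h₂ h₃.ne hk).trans (by linarith)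
  have hk0 : (0 : ℝ) < k := by exact_mod_cast hk
  have hN : (1 : ℝ) ≤ N := by exact_mod_cast hk.trans hkN
  rw [ENNReal.toReal_inv, ← one_div, Real.rpow_neg hk0.le, ← Real.sqrt_eq_rpow]
  have hNq : 1 ≤ (N : ℝ) ^ (1 / p₂.toReal) := Real.one_le_rpow hN (by positivity)
  have hs0 : 0 < √(k : ℝ) := by positivity
  rcases Nat.lt_or_ge 393216 k with hlt | hge
  · obtain ⟨n, rfl⟩ : ∃ n, k = n + 1 := ⟨k - 1, by omega⟩
    have hn0 : (1 : ℝ) ≤ n := by exact_mod_cast (by omega : 1 ≤ n)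
    have hsq : 1 / √(n : ℝ) ≤ 2 * (√((n + 1 : ℕ) : ℝ))⁻¹ := by
      rw [← div_eq_mul_inv, div_le_div_iff₀ (by positivity) hs0, one_mul]
      rw [Real.sqrt_le_left (by positivity), mul_pow, Real.sq_sqrt (by positivity)]
      push_cast
      linarith
    calc _ ≤ K * ((N : ℝ) ^ (1 / p₂.toReal) * (1 / √n)) := H n N (by omega) (by omega)
      _ ≤ K * ((N : ℝ) ^ (1 / p₂.toReal) * (2 * (√((n + 1 : ℕ) : ℝ))⁻¹)) := by gcongr
      _ = 2 * K * (N : ℝ) ^ (1 / p₂.toReal) * (√((n + 1 : ℕ) : ℝ))⁻¹ := by ring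
      _ ≤ _ := by gcongr; linarith
  · refine (kolmogorovNumber_lpId_le_one h₁ h₂ h₃.ne hk).trans ?_
    rw [← div_eq_mul_inv, le_div_iff₀ hs0, one_mul]
    have hsk : √(k : ℝ) ≤ 1000 := by
      rw [Real.sqrt_le_left (by norm_num)]
      have : (k : ℝ) ≤ 393216 := by exact_mod_cast hge
      linarith
    nlinarith
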